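/- Fix game G_i (true goal g_i, fake goal g_{3−i}) and suppose the Eater plays π^{E*}. If π^M is any admissible Mover strategy whose resulting path contains at least one explicit move toward the fake goal g_{3−i} (δd_{3−i}(t) = −1 and δd_i(t) = +1 for some t), then J_i(π^M, π^{E*}) ≥ J_i(π^{M*}_i, π^{E*}); i.e., deception by exaggeration does not benefit the Mover against π^{E*}. -/

import Mathlib

noncomputable section

open Classical

/-- Manhattan distance on the grid ℤ². -/
def mdist (p q : ℤ × ℤ) : ℤ := |p.1 - q.1| + |p.2 - q.2|

/-- The four admissible unit moves of the Mover. -/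
def IsUnitMove (e : ℤ × ℤ) : Prop :=
  e = (1, 0) ∨ e = (-1, 0) ∨ e = (0, 1) ∨ e = (0, -1)

/-- The Eater action that eats one banana from goal `j`. -/
def eatOne (j : Fin 2) : Fin 2 → ℝ := fun k => if k = j then 1 else 0

/-- The Eater action that eats half a banana from each goal. -/
def eatHalf : Fin 2 → ℝ := fun _ => 1 / 2

/-- The three admissible Eater actions. -/
def IsEaterAction (a : Fin 2 → ℝ) : Prop :=
  a = eatOne 0 ∨ a = eatOne 1 ∨ a = eatHalf

/-- A Mover strategy: maps (position, consumption vector) to a move. -/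
abbrev MoverStrategy : Type := ℤ × ℤ → (Fin 2 → ℝ) → ℤ × ℤ

/-- An Eater strategy: maps (new Mover position, last Mover move, current consumption)
to an Eater action; it is the same in both games. -/
abbrev EaterStrategy : Type := ℤ × ℤ → ℤ × ℤ → (Fin 2 → ℝ) → Fin 2 → ℝ

def ValidMover (piM : MoverStrategy) : Prop := ∀ p b, IsUnitMove (piM p b)

def ValidEater (piE : EaterStrategy) : Prop := ∀ p a b, IsEaterAction (piE p a b)

/-- State trajectory (position, consumption vector) of the game under a strategy pair:
`p(t+1) = p(t) + a^M(t)`, `b(t+1) = b(t) + a^E(t)`. -/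
def traj (piM : MoverStrategy) (piE : EaterStrategy) (p0 : ℤ × ℤ) (b0 : Fin 2 → ℝ) :
    ℕ → (ℤ × ℤ) × (Fin 2 → ℝ)
  | 0 => (p0, b0)
  | t + 1 =>
    let s := traj piM piE p0 b0 t
    let m := piM s.1 s.2
    (s.1 + m, fun j => s.2 j + piE (s.1 + m) m s.2 j)

/-- Termination time of game `G_i`: the first time the Mover's position equals `goal`. -/
def hitTime (piM : MoverStrategy) (piE : EaterStrategy) (p0 : ℤ × ℤ) (b0 : Fin 2 → ℝ)
    (goal : ℤ × ℤ) : ℕ :=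
  sInf {t | (traj piM piE p0 b0 t).1 = goal}

/-- The outcome `J_i` of game `G_i`: consumption at the true goal `g i` at termination. -/
def outcome (g : Fin 2 → ℤ × ℤ) (i : Fin 2) (piM : MoverStrategy) (piE : EaterStrategy)
    (p0 : ℤ × ℤ) (b0 : Fin 2 → ℝ) : ℝ :=
  (traj piM piE p0 b0 (hitTime piM piE p0 b0 (g i))).2 i

/-- Admissibility: the Mover reaches the goal in finite time. -/
def Reaches (piM : MoverStrategy) (piE : EaterStrategy) (p0 : ℤ × ℤ) (b0 : Fin 2 → ℝ)
    (goal : ℤ × ℤ) : Prop :=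
  ∃ t, (traj piM piE p0 b0 t).1 = goal

/-- A step from `p` to `p'` is ambiguous: `δd₁ = δd₂`. -/
def IsAmbStep (g : Fin 2 → ℤ × ℤ) (p p' : ℤ × ℤ) : Prop :=
  mdist p' (g 0) - mdist p (g 0) = mdist p' (g 1) - mdist p (g 1)

/-- A step from `p` to `p'` is explicit: `δd₁ = −δd₂`. -/
def IsExpStep (g : Fin 2 → ℤ × ℤ) (p p' : ℤ × ℤ) : Prop :=
  mdist p' (g 0) - mdist p (g 0) = -(mdist p' (g 1) - mdist p (g 1))

/-- A path of `T` unit moves from `p` to `goal`. -/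
def IsPath (p goal : ℤ × ℤ) (T : ℕ) (q : ℕ → ℤ × ℤ) : Prop :=
  q 0 = p ∧ q T = goal ∧ ∀ t < T, IsUnitMove (q (t + 1) - q t)

/-- Number of ambiguous moves along a path. -/
def ambCount (g : Fin 2 → ℤ × ℤ) (T : ℕ) (q : ℕ → ℤ × ℤ) : ℕ :=
  ((Finset.range T).filter fun t => IsAmbStep g (q t) (q (t + 1))).card

/-- Number of explicit moves along a path. -/
def expCount (g : Fin 2 → ℤ × ℤ) (T : ℕ) (q : ℕ → ℤ × ℤ) : ℕ :=
  ((Finset.range T).filter fun t => IsExpStep g (q t) (q (t + 1))).card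

/-- `n^a(p)`: minimum number of ambiguous moves over paths from `p` to a goal. -/
def naN (g : Fin 2 → ℤ × ℤ) (p : ℤ × ℤ) : ℕ :=
  sInf {n : ℕ | ∃ i : Fin 2, ∃ T q, IsPath p (g i) T q ∧ ambCount g T q = n}

/-- `n^r_i(p)`: minimum number of explicit moves needed to reach `g i` from `p`. -/
def nrN (g : Fin 2 → ℤ × ℤ) (i : Fin 2) (p : ℤ × ℤ) : ℕ :=
  sInf {n : ℕ | ∃ T q, IsPath p (g i) T q ∧ expCount g T q = n}

/-- The equilibrium Eater strategy `π^{E*}`: after an ambiguous Mover move the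
conservative action (based on the sign of `δ̃c₁`), after an explicit move the
exploiting action (eat from the approached goal). -/
def piEstar (g : Fin 2 → ℤ × ℤ) : EaterStrategy := fun p' a b =>
  let p := p' - a
  let d1 := mdist p' (g 0) - mdist p (g 0)
  let d2 := mdist p' (g 1) - mdist p (g 1)
  if d1 = d2 then
    if (b 0 + (mdist p' (g 0) : ℝ)) - (b 1 + (mdist p' (g 1) : ℝ)) < 0 then eatOne 0
    else if 0 < (b 0 + (mdist p' (g 0) : ℝ)) - (b 1 + (mdist p' (g 1) : ℝ)) then eatOne 1
    else eatHalf
  else if d1 < d2 then eatOne 0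
  else eatOne 1

/-- `π^{M*}_i`: the Mover strategy that (against any Eater strategy) follows a shortest
path from `p0` to `g i`, performing all `n^a(p0)` ambiguous moves first and then the
explicit moves. -/
def IsMoverStar (g : Fin 2 → ℤ × ℤ) (i : Fin 2) (p0 : ℤ × ℤ) (b0 : Fin 2 → ℝ)
    (piM : MoverStrategy) : Prop :=
  ValidMover piM ∧
  ∀ piE : EaterStrategy, ValidEater piE →
    (traj piM piE p0 b0 (mdist p0 (g i)).toNat).1 = g i ∧
    ∀ t < (mdist p0 (g i)).toNat,
      (IsAmbStep g (traj piM piE p0 b0 t).1 (traj piM piE p0 b0 (t + 1)).1 ↔ t < naN g p0)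

/-- `c_i(p, b) = b_i + d(p, g_i)`. -/
def cval (g : Fin 2 → ℤ × ℤ) (i : Fin 2) (p : ℤ × ℤ) (b : Fin 2 → ℝ) : ℝ :=
  b i + (mdist p (g i) : ℝ)

/-- `δc_i = c_i − c_{3−i}`. -/
def dcval (g : Fin 2 → ℤ × ℤ) (i : Fin 2) (p : ℤ × ℤ) (b : Fin 2 → ℝ) : ℝ :=
  cval g i p b - cval g (1 - i) p b

end


noncomputable section

def eD (D : ℝ) : ℝ := if D < 0 then 1 else if 0 < D then 0 else 1 / 2
def fD (D : ℝ) : ℝ := if D < 0 then D + 1 else if 0 < D then D - 1 else D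

def AA : ℕ → ℝ → ℝ
  | 0, _ => 0
  | n + 1, D => eD D + AA n (fD D)

lemma AA_step (n : ℕ) : ∀ D, AA n (D + 1) ≤ AA n D ∧ AA n D ≤ AA n (D + 1) + 1 := by
  induction n with
  | zero => intro D; simp [AA]
  | succ n ih =>
    intro D
    simp only [AA]
    rcases lt_trichotomy D 0 with h | h | h
    · rcases lt_trichotomy (D + 1) 0 with h' | h' | h'
      · have := ih (D + 1)
        simp only [eD, fD, h, h', if_true]
        constructor <;> linarith
      · have h1 : fD D = 0 := by simp [fD, h, h']
        have h2 : fD (D + 1) = 0 := by simp [fD, h']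
        have h3 : eD D = 1 := by simp [eD, h]
        have h4 : eD (D + 1) = 1 / 2 := by simp [eD, h']
        rw [h1, h2, h3, h4]
        constructor <;> linarith
      · have := ih D
        have h1 : fD D = D + 1 := by simp [fD, h]
        have h2 : fD (D + 1) = D := by simp [fD, h', h'.le.not_gt]
        have h3 : eD D = 1 := by simp [eD, h]
        have h4 : eD (D + 1) = 0 := by simp [eD, h', h'.le.not_gt]
        rw [h1, h2, h3, h4]
        constructor <;> linarith
    · subst h
      have h1 : fD 0 = 0 := by simp [fD]
      have h2 : fD (0 + 1) = 0 := by norm_num [fD]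
      have h3 : eD 0 = 1 / 2 := by simp [eD]
      have h4 : eD (0 + 1) = 0 := by norm_num [eD]
      rw [h1, h2, h3, h4]
      constructor <;> linarith
    · have h' : 0 < D + 1 := by linarith
      have := ih (D - 1)
      have h1 : fD D = D - 1 := by simp [fD, h, h.le.not_gt]
      have h2 : fD (D + 1) = D - 1 + 1 := by simp [fD, h', h'.le.not_gt]
      have h3 : eD D = 0 := by simp [eD, h, h.le.not_gt]
      have h4 : eD (D + 1) = 0 := by simp [eD, h', h'.le.not_gt]
      rw [h1, h2, h3, h4]
      constructor <;> linarith

lemma eD_nonneg (D : ℝ) : 0 ≤ eD D := by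
  unfold eD; split_ifs <;> norm_num

lemma AA_mono (n : ℕ) : ∀ D, AA n D ≤ AA (n + 1) D := by
  induction n with
  | zero => intro D; simp [AA, eD_nonneg]
  | succ n ih =>
    intro D
    have := ih (fD D)
    simp only [AA] at this ⊢
    linarith

def NN (g : Fin 2 → ℤ × ℤ) (p : ℤ × ℤ) : ℕ :=
  ((mdist p (g 0) + mdist p (g 1) - mdist (g 0) (g 1)) / 2).toNat

lemma NN_spec (g : Fin 2 → ℤ × ℤ) (p : ℤ × ℤ) :
    2 * (NN g p : ℤ) = mdist p (g 0) + mdist p (g 1) - mdist (g 0) (g 1) := by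
  have key : ∀ x a b : ℤ, ∃ k : ℤ, 0 ≤ k ∧ |x - a| + |x - b| - |a - b| = 2 * k := by
    intro x a b
    refine ⟨(|x - a| + |x - b| - |a - b|) / 2, ?_, ?_⟩ <;>
    rcases abs_cases (x - a) with h | h <;> rcases abs_cases (x - b) with h' | h' <;>
      rcases abs_cases (a - b) with h'' | h'' <;> omega
  obtain ⟨k, hk, e⟩ := key p.1 (g 0).1 (g 1).1
  obtain ⟨l, hl, e'⟩ := key p.2 (g 0).2 (g 1).2
  unfold NN mdist
  omega

lemma mdist_step (p m q : ℤ × ℤ) (hm : IsUnitMove m) :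
    mdist (p + m) q = mdist p q + 1 ∨ mdist (p + m) q = mdist p q - 1 := by
  have key : ∀ x a : ℤ, (|x + 1 - a| = |x - a| + 1 ∨ |x + 1 - a| = |x - a| - 1) ∧
      (|x + -1 - a| = |x - a| + 1 ∨ |x + -1 - a| = |x - a| - 1) := by
    intro x a
    rcases abs_cases (x - a) with h | h <;> rcases abs_cases (x + 1 - a) with h' | h' <;>
      rcases abs_cases (x + -1 - a) with h'' | h'' <;> omega
  have k1 := key p.1 q.1
  have k2 := key p.2 q.2
  unfold mdist
  rcases hm with rfl | rfl | rfl | rfl <;>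
    simp only [Prod.fst_add, Prod.snd_add, add_zero] <;> omega

lemma step_lemma (g : Fin 2 → ℤ × ℤ) (i : Fin 2) (p m : ℤ × ℤ) (b b' : Fin 2 → ℝ)
    (hm : IsUnitMove m) (hb : b' = fun j => b j + piEstar g (p + m) m b j) :
    (IsAmbStep g p (p + m) ∧ b' i = b i + eD (dcval g i p b) ∧
      dcval g i (p + m) b' = fD (dcval g i p b) ∧
      ((mdist (p + m) (g i) = mdist p (g i) - 1 ∧ NN g p = NN g (p + m) + 1) ∨
       (mdist (p + m) (g i) = mdist p (g i) + 1 ∧ NN g (p + m) = NN g p + 1))) ∨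
    (¬ IsAmbStep g p (p + m) ∧ NN g (p + m) = NN g p ∧
      mdist (p + m) (g i) = mdist p (g i) - 1 ∧ b' i = b i + 1 ∧
      dcval g i (p + m) b' = dcval g i p b - 1) ∨
    (¬ IsAmbStep g p (p + m) ∧ NN g (p + m) = NN g p ∧
      mdist (p + m) (g i) = mdist p (g i) + 1 ∧ b' i = b i ∧
      dcval g i (p + m) b' = dcval g i p b + 1) := by
  have n1 := NN_spec g p
  have n2 := NN_spec g (p + m)
  have s0 := mdist_step p m (g 0) hm
  have s1 := mdist_step p m (g 1) hm
  have b0 : b' 0 = b 0 + piEstar g (p + m) m b 0 := by rw [hb]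
  have b1 : b' 1 = b 1 + piEstar g (p + m) m b 1 := by rw [hb]
  clear hb
  simp only [piEstar, add_sub_cancel_right] at b0 b1
  unfold IsAmbStep
  generalize hx0' : mdist (p + m) (g 0) = x0' at *
  generalize hx0 : mdist p (g 0) = x0 at *
  generalize hx1' : mdist (p + m) (g 1) = x1' at *
  generalize hx1 : mdist p (g 1) = x1 at *
  have f0 : ∀ (_ : i = 0), dcval g i p b = (b 0 + x0) - (b 1 + x1) ∧
      dcval g i (p + m) b' = (b' 0 + x0') - (b' 1 + x1') := by
    rintro rfl
    simp [dcval, cval, hx0, hx1, hx0', hx1']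
  have f1 : ∀ (_ : i = 1), dcval g i p b = (b 1 + x1) - (b 0 + x0) ∧
      dcval g i (p + m) b' = (b' 1 + x1') - (b' 0 + x0') := by
    rintro rfl
    simp [dcval, cval, hx0, hx1, hx0', hx1']
  have gi : (i = 0 ∧ mdist p (g i) = x0 ∧ mdist (p + m) (g i) = x0') ∨
      (i = 1 ∧ mdist p (g i) = x1 ∧ mdist (p + m) (g i) = x1') := by
    fin_cases i <;> simp [hx0, hx1, hx0', hx1']
  rcases gi with ⟨hi, q1, q2⟩ | ⟨hi, q1, q2⟩
  · obtain ⟨r1, r2⟩ := f0 hi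
    rw [q1, q2, r1, r2, hi]
    clear f0 f1 r1 r2 q1 q2 hi hx0 hx1 hx0' hx1'
    rcases s0 with rfl | rfl <;> rcases s1 with rfl | rfl
    · left
      rw [b0, b1]
      refine ⟨by ring, ?_, ?_, Or.inr ⟨rfl, by omega⟩⟩
      · try simp only [eD, fD]
        push_cast
        split_ifs <;> simp [eatOne, eatHalf] <;> first | linarith | (exfalso; first | omega | linarith)
      · try simp only [eD, fD]
        push_cast
        split_ifs <;> simp [eatOne, eatHalf] <;> first | linarith | (exfalso; first | omega | linarith)
    · right; right
      rw [b0, b1]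
      refine ⟨by omega, by omega, rfl, ?_, ?_⟩
      · try simp only [eD, fD]
        push_cast
        split_ifs <;> simp [eatOne, eatHalf] <;> first | linarith | (exfalso; first | omega | linarith)
      · try simp only [eD, fD]
        push_cast
        split_ifs <;> simp [eatOne, eatHalf] <;> first | linarith | (exfalso; first | omega | linarith)
    · right; left
      rw [b0, b1]
      refine ⟨by omega, by omega, rfl, ?_, ?_⟩
      · try simp only [eD, fD]
        push_cast
        split_ifs <;> simp [eatOne, eatHalf] <;> first | linarith | (exfalso; first | omega | linarith)
      · try simp only [eD, fD]
        push_cast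
        split_ifs <;> simp [eatOne, eatHalf] <;> first | linarith | (exfalso; first | omega | linarith)
    · left
      rw [b0, b1]
      refine ⟨by ring, ?_, ?_, Or.inl ⟨rfl, by omega⟩⟩
      · try simp only [eD, fD]
        push_cast
        split_ifs <;> simp [eatOne, eatHalf] <;> first | linarith | (exfalso; first | omega | linarith)
      · try simp only [eD, fD]
        push_cast
        split_ifs <;> simp [eatOne, eatHalf] <;> first | linarith | (exfalso; first | omega | linarith)
  · obtain ⟨r1, r2⟩ := f1 hi
    rw [q1, q2, r1, r2, hi]
    clear f0 f1 r1 r2 q1 q2 hi hx0 hx1 hx0' hx1'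
    rcases s1 with rfl | rfl <;> rcases s0 with rfl | rfl
    · left
      rw [b0, b1]
      refine ⟨by ring, ?_, ?_, Or.inr ⟨rfl, by omega⟩⟩
      · try simp only [eD, fD]
        push_cast
        split_ifs <;> simp [eatOne, eatHalf] <;> first | linarith | (exfalso; first | omega | linarith)
      · try simp only [eD, fD]
        push_cast
        split_ifs <;> simp [eatOne, eatHalf] <;> first | linarith | (exfalso; first | omega | linarith)
    · right; right
      rw [b0, b1]
      refine ⟨by omega, by omega, rfl, ?_, ?_⟩
      · try simp only [eD, fD]
        push_cast
        split_ifs <;> simp [eatOne, eatHalf] <;> first | linarith | (exfalso; first | omega | linarith)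
      · try simp only [eD, fD]
        push_cast
        split_ifs <;> simp [eatOne, eatHalf] <;> first | linarith | (exfalso; first | omega | linarith)
    · right; left
      rw [b0, b1]
      refine ⟨by omega, by omega, rfl, ?_, ?_⟩
      · try simp only [eD, fD]
        push_cast
        split_ifs <;> simp [eatOne, eatHalf] <;> first | linarith | (exfalso; first | omega | linarith)
      · try simp only [eD, fD]
        push_cast
        split_ifs <;> simp [eatOne, eatHalf] <;> first | linarith | (exfalso; first | omega | linarith)
    · left
      rw [b0, b1]
      refine ⟨by ring, ?_, ?_, Or.inl ⟨rfl, by omega⟩⟩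
      · try simp only [eD, fD]
        push_cast
        split_ifs <;> simp [eatOne, eatHalf] <;> first | linarith | (exfalso; first | omega | linarith)
      · try simp only [eD, fD]
        push_cast
        split_ifs <;> simp [eatOne, eatHalf] <;> first | linarith | (exfalso; first | omega | linarith)

def VV (g : Fin 2 → ℤ × ℤ) (i : Fin 2) (s : (ℤ × ℤ) × (Fin 2 → ℝ)) : ℝ :=
  s.2 i + AA (NN g s.1) (dcval g i s.1 s.2) + mdist s.1 (g i) - NN g s.1

lemma VV_goal (g : Fin 2 → ℤ × ℤ) (i : Fin 2) (s : (ℤ × ℤ) × (Fin 2 → ℝ)) (h : s.1 = g i) :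
    VV g i s = s.2 i := by
  have h0 : mdist (g i) (g i) = 0 := by simp [mdist]
  have hN : NN g (g i) = 0 := by
    have := NN_spec g (g i)
    have c : mdist (g 1) (g 0) = mdist (g 0) (g 1) := by
      simp only [mdist, abs_sub_comm]
    fin_cases i <;> simp at * <;> omega
  simp [VV, h, h0, hN, AA]

lemma VV_step (g : Fin 2 → ℤ × ℤ) (i : Fin 2) (piM : MoverStrategy) (hM : ValidMover piM)
    (p0 : ℤ × ℤ) (b0 : Fin 2 → ℝ) (t : ℕ) :
    VV g i (traj piM (piEstar g) p0 b0 t) ≤ VV g i (traj piM (piEstar g) p0 b0 (t + 1)) := by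
  simp only [traj]
  set s := traj piM (piEstar g) p0 b0 t
  set m := piM s.1 s.2 with hm
  set b' : Fin 2 → ℝ := fun j => s.2 j + piEstar g (s.1 + m) m s.2 j with hb'
  have := step_lemma g i s.1 m s.2 b' (hM _ _) hb'
  simp only [VV]
  rcases this with ⟨-, e1, e2, (⟨e3, e4⟩ | ⟨e3, e4⟩)⟩ | ⟨-, e1, e2, e3, e4⟩ | ⟨-, e1, e2, e3, e4⟩
  · rw [e1, e2, e3, e4]; simp only [AA]; push_cast; linarith
  · rw [e1, e2, e3, e4]
    have h1 := AA_mono (NN g s.1) (dcval g i s.1 s.2)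
    have h2 := AA_mono (NN g s.1 + 1) (dcval g i s.1 s.2)
    have h3 : AA (NN g s.1 + 1 + 1) (dcval g i s.1 s.2) = eD (dcval g i s.1 s.2) +
      AA (NN g s.1 + 1) (fD (dcval g i s.1 s.2)) := rfl
    push_cast; linarith
  · rw [e1, e2, e3, e4]
    have h1 := AA_step (NN g s.1) (dcval g i s.1 s.2 - 1)
    rw [sub_add_cancel] at h1; push_cast; linarith
  · rw [e1, e2, e3, e4]
    have h1 := AA_step (NN g s.1) (dcval g i s.1 s.2)
    push_cast; linarith

lemma valid_star (g : Fin 2 → ℤ × ℤ) : ValidEater (piEstar g) := by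
  intro p a b
  simp only [piEstar, IsEaterAction]
  split_ifs <;> simp

lemma traj_hit (piM : MoverStrategy) (piE : EaterStrategy) (p0 : ℤ × ℤ) (b0 : Fin 2 → ℝ)
    (q : ℤ × ℤ) (h : Reaches piM piE p0 b0 q) :
    (traj piM piE p0 b0 (hitTime piM piE p0 b0 q)).1 = q :=
  Nat.sInf_mem (s := {t | (traj piM piE p0 b0 t).1 = q}) h

lemma traj_dist (piM : MoverStrategy) (hM : ValidMover piM) (piE : EaterStrategy)
    (p0 : ℤ × ℤ) (b0 : Fin 2 → ℝ) (q : ℤ × ℤ) (t k : ℕ) :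
    mdist (traj piM piE p0 b0 t).1 q ≤ mdist (traj piM piE p0 b0 (t + k)).1 q + k := by
  induction k with
  | zero => simp
  | succ k ih =>
    have := mdist_step (traj piM piE p0 b0 (t + k)).1
      (piM (traj piM piE p0 b0 (t + k)).1 (traj piM piE p0 b0 (t + k)).2) q (hM _ _)
    rw [← add_assoc]
    simp only [traj]
    push_cast
    omega

lemma star_const (g : Fin 2 → ℤ × ℤ) (i : Fin 2) (p0 : ℤ × ℤ) (b0 : Fin 2 → ℝ)
    (piM : MoverStrategy) (hs : IsMoverStar g i p0 b0 piM) (t : ℕ)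
    (ht : t ≤ (mdist p0 (g i)).toNat) :
    VV g i (traj piM (piEstar g) p0 b0 t) = VV g i (p0, b0) := by
  obtain ⟨hM, h⟩ := hs
  obtain ⟨hT, hA⟩ := h _ (valid_star g)
  set T := (mdist p0 (g i)).toNat with hTd
  have hpos : 0 ≤ mdist p0 (g i) := by unfold mdist; positivity
  have hd : ∀ t ≤ T, mdist (traj piM (piEstar g) p0 b0 t).1 (g i) = (T : ℤ) - t := by
    intro t ht
    have h1 := traj_dist piM hM (piEstar g) p0 b0 (g i) 0 t
    have h2 := traj_dist piM hM (piEstar g) p0 b0 (g i) t (T - t)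
    have h3 : mdist (g i) (g i) = 0 := by simp [mdist]
    rw [Nat.add_sub_cancel' ht, hT, h3] at h2
    rw [zero_add] at h1
    simp only [traj] at h1
    omega
  have hstep : ∀ t, _ := fun t => step_lemma g i (traj piM (piEstar g) p0 b0 t).1
      (piM (traj piM (piEstar g) p0 b0 t).1 (traj piM (piEstar g) p0 b0 t).2)
      (traj piM (piEstar g) p0 b0 t).2 (traj piM (piEstar g) p0 b0 (t + 1)).2 (hM _ _) rfl
  have hN : ∀ k t, t + k = T → naN g p0 ≤ t → NN g (traj piM (piEstar g) p0 b0 t).1 = 0 := by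
    intro k
    induction k with
    | zero =>
      intro t h _
      rw [add_zero] at h
      have c : mdist (g 1) (g 0) = mdist (g 0) (g 1) := by
        simp only [mdist, abs_sub_comm]
      have h3 : ∀ i, mdist (g i) (g i) = 0 := by simp [mdist]
      rw [h, hT]
      have := NN_spec g (g i)
      have h30 := h3 0
      have h31 := h3 1
      fin_cases i <;> simp at * <;> omega
    | succ k ih =>
      intro t h h'
      have h1 := ih (t + 1) (by omega) (by omega)
      have h2 := (hA t (by omega)).not.mpr (by omega)
      simp only [traj] at h1 h2
      rcases hstep t with e | e | e
      · exact absurd e.1 h2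
      · omega
      · omega
  induction t with
  | zero => simp [traj]
  | succ t ih =>
    rw [← ih (by omega)]
    have d1 := hd t (by omega)
    have d2 := hd (t + 1) ht
    have hh := hstep t
    have hAt := hA t (by omega)
    have hNt := hN (T - t) t (by omega)
    have hp : (traj piM (piEstar g) p0 b0 (t + 1)).1 = (traj piM (piEstar g) p0 b0 t).1 +
      piM (traj piM (piEstar g) p0 b0 t).1 (traj piM (piEstar g) p0 b0 t).2 := rfl
    rw [← hp] at hh
    generalize traj piM (piEstar g) p0 b0 (t + 1) = s' at *
    generalize traj piM (piEstar g) p0 b0 t = s at *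
    simp only [VV]
    push_cast at d2
    rcases hh with ⟨-, e1, e2, (⟨e3, e4⟩ | ⟨e3, e4⟩)⟩ | ⟨e0, e1, e2, e3, e4⟩ | ⟨e0, e1, e2, e3, e4⟩
    · rw [e1, e2, e3, e4]; simp only [AA]; push_cast; linarith
    · omega
    · have hz := hNt (by by_contra hc; exact e0 (hAt.mpr (by omega)))
      rw [e1, e2, e3, hz]; simp only [AA]; push_cast; linarith
    · omega

end

/-- No Exaggeration: an explicit move toward the fake goal `g_{3−i}`
(`δd_{3−i} = −1`, `δd_i = +1`) does not benefit the Mover against `π^{E*}`. -/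
theorem no_exaggeration
    (g : Fin 2 → ℤ × ℤ) (hg : g 0 ≠ g 1) (p0 : ℤ × ℤ) (b0 : Fin 2 → ℝ)
    (hb0 : ∀ j, 0 ≤ b0 j) (i : Fin 2)
    (piM : MoverStrategy) (hM : ValidMover piM)
    (hadm : Reaches piM (piEstar g) p0 b0 (g i))
    (hdev : ∃ t, t < hitTime piM (piEstar g) p0 b0 (g i) ∧
      mdist (traj piM (piEstar g) p0 b0 (t + 1)).1 (g (1 - i)) -
        mdist (traj piM (piEstar g) p0 b0 t).1 (g (1 - i)) = -1 ∧
      mdist (traj piM (piEstar g) p0 b0 (t + 1)).1 (g i) -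
        mdist (traj piM (piEstar g) p0 b0 t).1 (g i) = 1)
    (piMstar : MoverStrategy) (hstar : IsMoverStar g i p0 b0 piMstar) :
    outcome g i piMstar (piEstar g) p0 b0 ≤ outcome g i piM (piEstar g) p0 b0 := by
  obtain ⟨hMs, h⟩ := id hstar
  obtain ⟨hT, -⟩ := h _ (valid_star g)
  have hle : hitTime piMstar (piEstar g) p0 b0 (g i) ≤ (mdist p0 (g i)).toNat :=
    Nat.sInf_le (s := {t | (traj piMstar (piEstar g) p0 b0 t).1 = g i}) hT
  have h1 := star_const g i p0 b0 piMstar hstar _ hle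
  rw [VV_goal g i _ (traj_hit _ _ _ _ _ ⟨_, hT⟩)] at h1
  have h2 := monotone_nat_of_le_succ (VV_step g i piM hM p0 b0)
    (Nat.zero_le (hitTime piM (piEstar g) p0 b0 (g i)))
  rw [VV_goal g i _ (traj_hit _ _ _ _ _ hadm)] at h2
  unfold outcome
  rw [h1]
  exact h2
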